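/- Let U be a subcritical update family in two dimensions. Then p_c(ℤ², U) > 0. -/

import Mathlib

open Set MeasureTheory

/-- A site of the two-dimensional lattice. -/
abbrev Site : Type := ℤ × ℤ

/-- One step of the `U`-bootstrap process. -/
def bsStep (U : Finset (Finset Site)) (A : Set Site) : Set Site :=
  A ∪ {x : Site | ∃ X ∈ U, ∀ y ∈ X, y + x ∈ A}

/-- The `t`-th stage of the `U`-bootstrap process started from `A`. -/
def bsIter (U : Finset (Finset Site)) : ℕ → Set Site → Set Site
  | 0, A => A
  | n + 1, A => bsStep U (bsIter U n A)

/-- The closure `[A]` under the `U`-bootstrap process. -/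
def bsClosure (U : Finset (Finset Site)) (A : Set Site) : Set Site :=
  ⋃ n : ℕ, bsIter U n A

/-- `U` is an update family: a (finite) collection of finite nonempty subsets of `ℤ² \ {0}`. -/
def IsUpdateFamily (U : Finset (Finset Site)) : Prop :=
  U.Nonempty ∧ ∀ X ∈ U, X.Nonempty ∧ (0 : Site) ∉ X

/-- The discrete half-plane `H_u` determined by `u ∈ ℝ²`. -/
def halfPlane (u : ℝ × ℝ) : Set Site :=
  {x : Site | (x.1 : ℝ) * u.1 + (x.2 : ℝ) * u.2 < 0}

/-- A direction `u` is stable for `U` if `[H_u] = H_u`. -/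
def IsStableDir (U : Finset (Finset Site)) (u : ℝ × ℝ) : Prop :=
  bsClosure U (halfPlane u) = halfPlane u

/-- The unit vector of angle `θ`. -/
noncomputable def dir (θ : ℝ) : ℝ × ℝ := (Real.cos θ, Real.sin θ)

/-- `dir θ` lies in the interior of the stable set (is strongly stable). -/
def IsStronglyStableAngle (U : Finset (Finset Site)) (θ : ℝ) : Prop :=
  ∃ ε > 0, ∀ φ : ℝ, |φ - θ| < ε → IsStableDir U (dir φ)

/-- `U` is subcritical: every open semicircle contains a strongly stable direction. -/
def Subcritical (U : Finset (Finset Site)) : Prop :=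
  ∀ θ : ℝ, ∃ φ : ℝ, θ < φ ∧ φ < θ + Real.pi ∧ IsStronglyStableAngle U φ

/-- `U` is supercritical: some open semicircle contains no stable direction. -/
def Supercritical (U : Finset (Finset Site)) : Prop :=
  ∃ θ : ℝ, ∀ φ : ℝ, θ < φ → φ < θ + Real.pi → ¬ IsStableDir U (dir φ)

/-- The random set of infected sites determined by `ω`. -/
def siteSet (ω : Site → Bool) : Set Site := {x : Site | ω x = true}

/-- `μ` is the Bernoulli product measure with density `p` on `ℤ²`:
each site lies in the random set independently with probability `p`. -/
def IsBernoulli (p : ℝ) (μ : Measure (Site → Bool)) : Prop :=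
  ∀ (s : Finset Site) (f : Site → Bool),
    μ {ω : Site → Bool | ∀ x ∈ s, ω x = f x}
      = ∏ x ∈ s, ENNReal.ofReal (if f x then p else 1 - p)

/-- `A` percolates: its closure is all of `ℤ²`. -/
def Percolates (U : Finset (Finset Site)) (A : Set Site) : Prop :=
  bsClosure U A = Set.univ

/-- The critical probability `p_c(ℤ², U)`. -/
noncomputable def critProb (U : Finset (Finset Site)) : ℝ :=
  sInf {p : ℝ | p ∈ Set.Icc (0 : ℝ) 1 ∧
    ∀ μ : Measure (Site → Bool), IsBernoulli p μ →
      μ {ω : Site → Bool | Percolates U (siteSet ω)} = 1}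

/-- Euclidean embedding of the lattice into the complex plane. -/
noncomputable def toC (v : Site) : ℂ := ⟨(v.1 : ℝ), (v.2 : ℝ)⟩

/-- The range `r(U)`: the largest Euclidean distance between two sites of one update rule. -/
noncomputable def famRange (U : Finset (Finset Site)) : ℝ :=
  (U.sup fun X => X.sup fun a => X.sup fun b => nndist (toC a) (toC b) : NNReal)


/-- A finite set of sites is `B`-connected: a subset that meets it and is closed under steps in `B`
inside it contains it. -/
def StepConnected (B V : Finset Site) : Prop :=
  ∀ S : Set Site, (∃ x ∈ V, x ∈ S) → (∀ u ∈ V, u ∈ S → ∀ w ∈ V, w - u ∈ B → w ∈ S) →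
    ∀ w ∈ V, w ∈ S

/-- Data witnessing that infection in the growing sequence `S` started from `A` spreads only
against each of the linear functionals `f i`, whose sum vanishes: every infected site `x ∉ A` has,
for each `i`, an earlier infected site `e i x` nearby on which `f i` is larger by at least `c`. The
steps between these sites lie in `B`, and a step changes the `f i` by at most `C` in total. -/
structure Explanation (ι : Type) [Fintype ι] (B : Finset Site) (c C : ℝ) (A : Set Site)
    (S : ℕ → Set Site) where
  /-- The explaining sites. -/
  e : ι → Site → Site
  /-- The functionals. -/
  f : ι → Site →+ ℝ
  zero_eq : S 0 = A
  e_of_mem : ∀ x ∈ A, ∀ i, e i x = x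
  e_mem : ∀ t, ∀ x ∈ S (t + 1), ∀ i, e i x ∈ S t
  gain : ∀ t, ∀ x ∈ S t, x ∉ A → ∀ i, f i x + c ≤ f i (e i x)
  sum_eq_zero : ∀ x, ∑ i, f i x = 0
  neg_mem : ∀ b ∈ B, -b ∈ B
  step_mem : ∀ i x, e i x - x ∈ B
  fork_mem : ∀ i j x, e j x - e i x ∈ B
  cost_le : ∀ b ∈ B, ∑ i, |f i b| ≤ C
  c_pos : 0 < c

namespace StepConnected

variable {B V W : Finset Site}

theorem singleton (x : Site) : StepConnected B {x} := by
  rintro S ⟨y, hy, hyS⟩ - w hw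
  simp_all

theorem union (hB : ∀ b ∈ B, -b ∈ B) (hV : StepConnected B V) (hW : StepConnected B W)
    {a b : Site} (ha : a ∈ V) (hb : b ∈ W) (hab : b - a ∈ B) : StepConnected B (V ∪ W) := by
  rintro S ⟨x, hx, hxS⟩ hS
  have hba : a - b ∈ B := by simpa using hB _ hab
  have hSV : (∃ x ∈ V, x ∈ S) → ∀ w ∈ V, w ∈ S := fun h ↦ hV S h fun u hu huS w hw ↦
    hS u (Finset.mem_union_left _ hu) huS w (Finset.mem_union_left _ hw)
  have hSW : (∃ x ∈ W, x ∈ S) → ∀ w ∈ W, w ∈ S := fun h ↦ hW S h fun u hu huS w hw ↦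
    hS u (Finset.mem_union_right _ hu) huS w (Finset.mem_union_right _ hw)
  have hVW : a ∈ S → b ∈ S := fun h ↦
    hS a (Finset.mem_union_left _ ha) h b (Finset.mem_union_right _ hb) hab
  have hWV : b ∈ S → a ∈ S := fun h ↦
    hS b (Finset.mem_union_right _ hb) h a (Finset.mem_union_left _ ha) hba
  have hboth : (∀ w ∈ V, w ∈ S) ∧ ∀ w ∈ W, w ∈ S := by
    rcases Finset.mem_union.1 hx with hx | hx
    · have h := hSV ⟨x, hx, hxS⟩
      exact ⟨h, hSW ⟨b, hb, hVW (h a ha)⟩⟩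
    · have h := hSW ⟨x, hx, hxS⟩
      exact ⟨hSV ⟨a, ha, hWV (h b hb)⟩, h⟩
  intro w hw
  exact (Finset.mem_union.1 hw).elim (hboth.1 w) (hboth.2 w)

/-- A `B`-connected set is covered by a depth-first walk. -/
theorem exists_walk (hB : ∀ b ∈ B, -b ∈ B) (hV : StepConnected B V) {x : Site} (hx : x ∈ V)
    {k : ℕ} (hk : k + 1 ≤ V.card) :
    ∃ l : List Site, l.IsChain (fun u w ↦ w - u ∈ B) ∧ l.head? = some x ∧
      l.length = 2 * k + 1 ∧ l.toFinset ⊆ V ∧ l.toFinset.card = k + 1 := by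
  induction k with
  | zero => exact ⟨[x], by simp, by simp, by simp, by simpa using hx, by simp⟩
  | succ k ih =>
    obtain ⟨l, hl, hlx, hlen, hlV, hcard⟩ := ih (by omega)
    have hxl : x ∈ l := List.mem_of_head? hlx
    obtain ⟨u, hu, w, hw, hwl, huw⟩ : ∃ u ∈ l, ∃ w ∈ V, w ∉ l ∧ w - u ∈ B := by
      by_contra! h
      have hsub : V ⊆ l.toFinset := fun w hw ↦ List.mem_toFinset.2 <|
        hV {z | z ∈ l} ⟨x, hx, hxl⟩ (fun u _ hul w hw huw ↦ by
          by_contra hwl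
          exact h u hul w hw hwl huw) w hw
      have := Finset.card_le_card hsub
      omega
    obtain ⟨l₁, l₂, rfl⟩ := List.append_of_mem hu
    have hwu : u - w ∈ B := by simpa using hB _ huw
    have hset : (l₁ ++ u :: w :: u :: l₂).toFinset = insert w (l₁ ++ u :: l₂).toFinset := by
      ext z
      simp only [List.mem_toFinset, List.mem_append, List.mem_cons, Finset.mem_insert]
      tauto
    refine ⟨l₁ ++ u :: w :: u :: l₂, ?_, ?_, ?_, ?_, ?_⟩
    · rw [List.isChain_split] at hl ⊢
      exact ⟨hl.1, List.isChain_cons_cons.2 ⟨huw, List.isChain_cons_cons.2 ⟨hwu, hl.2⟩⟩⟩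
    · cases l₁ <;> simpa using hlx
    · simp only [List.length_append, List.length_cons] at hlen ⊢
      omega
    · rw [hset]
      exact Finset.insert_subset hw hlV
    · rw [hset, Finset.card_insert_of_notMem (by rwa [List.mem_toFinset]), hcard]

end StepConnected

/-- The ranges of the walks of `n` steps in `B` started at `x`. -/
def walkRanges (B : Finset Site) : ℕ → Site → Finset (Finset Site)
  | 0, x => {{x}}
  | n + 1, x => B.biUnion fun b ↦ (walkRanges B n (x + b)).image (insert x)

namespace walkRanges

variable {B : Finset Site}

theorem card_le (n : ℕ) (x : Site) : (walkRanges B n x).card ≤ B.card ^ n := by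
  induction n generalizing x with
  | zero => simp [walkRanges]
  | succ n ih =>
    rw [walkRanges, pow_succ, mul_comm]
    exact Finset.card_biUnion_le_card_mul _ _ _ fun b _ ↦ Finset.card_image_le.trans (ih _)

theorem card_range_le {n : ℕ} {x : Site} {R : Finset Site} (hR : R ∈ walkRanges B n x) :
    R.card ≤ n + 1 := by
  induction n generalizing x R with
  | zero => simp_all [walkRanges]
  | succ n ih =>
    simp only [walkRanges, Finset.mem_biUnion, Finset.mem_image] at hR
    obtain ⟨b, -, R, hR, rfl⟩ := hR
    exact (Finset.card_insert_le _ _).trans (Nat.succ_le_succ (ih hR))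

theorem start_mem {n : ℕ} {x : Site} {R : Finset Site} (hR : R ∈ walkRanges B n x) : x ∈ R := by
  cases n with
  | zero => simp_all [walkRanges]
  | succ n =>
    simp only [walkRanges, Finset.mem_biUnion, Finset.mem_image] at hR
    obtain ⟨b, -, R, -, rfl⟩ := hR
    exact Finset.mem_insert_self _ _

theorem mono (hB : 0 ∈ B) (x : Site) : Monotone fun n ↦ walkRanges B n x := by
  refine monotone_nat_of_le_succ fun n R hR ↦ ?_
  simp only [walkRanges, Finset.mem_biUnion, Finset.mem_image]
  exact ⟨0, hB, R, by simpa using hR, Finset.insert_eq_self.2 (start_mem hR)⟩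

theorem toFinset_mem {x : Site} {l : List Site}
    (hl : (x :: l).IsChain fun u w ↦ w - u ∈ B) :
    (x :: l).toFinset ∈ walkRanges B l.length x := by
  induction l generalizing x with
  | nil => simp [walkRanges]
  | cons y l ih =>
    rw [List.isChain_cons_cons] at hl
    simp only [List.length_cons, walkRanges, Finset.mem_biUnion, Finset.mem_image]
    exact ⟨y - x, hl.1, (y :: l).toFinset, by simpa using ih hl.2, by simp⟩

end walkRanges

theorem StepConnected.mem_walkRanges {B V : Finset Site} (hB : ∀ b ∈ B, -b ∈ B)
    (hV : StepConnected B V) {x : Site} (hx : x ∈ V) :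
    V ∈ walkRanges B (2 * (V.card - 1)) x := by
  have hpos : 0 < V.card := Finset.card_pos.2 ⟨x, hx⟩
  obtain ⟨l, hl, hlx, hlen, hlV, hcard⟩ := hV.exists_walk hB hx (k := V.card - 1) (by omega)
  obtain rfl : l.toFinset = V := Finset.eq_of_subset_of_card_le hlV (by omega)
  cases l with
  | nil => simp at hlx
  | cons y l =>
    obtain rfl : y = x := by simpa using hlx
    have := walkRanges.toFinset_mem hl
    rwa [show l.length = 2 * ((y :: l).toFinset.card - 1) by simpa using hlen] at this

namespace Explanation

variable {ι : Type} [Fintype ι] {A : Set Site} {S : ℕ → Set Site} {B : Finset Site}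
  {c C : ℝ} (E : Explanation ι B c C A S)

/-- `E.Desc x z`: the initially infected site `z` is reached from `x` by iterated explanations. -/
inductive Desc : Site → Site → Prop
  | refl (a : Site) : a ∈ A → Desc a a
  | step (x : Site) (i : ι) (z : Site) : x ∉ A → Desc (E.e i x) z → Desc x z

/-- `K` cannot be split into two nonempty parts without common descendants. -/
def Linked (K : Finset Site) : Prop :=
  ∀ T ⊆ K, T.Nonempty → T ≠ K → ∃ a ∈ T, ∃ b ∈ K \ T, ∃ z, E.Desc a z ∧ E.Desc b z

open Classical in
/-- Every choice of poles in `K` lies in a connected set of sites whose initially infected sites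
descend from `K` and are numerous in terms of the other sites and of the span of the poles. -/
def Good (K : Finset Site) : Prop :=
  ∀ v : ι → Site, (∀ i, v i ∈ K) → ∃ V : Finset Site, StepConnected B V ∧ (∀ i, v i ∈ V) ∧
    (∀ z ∈ V, z ∈ A → ∃ k ∈ K, E.Desc k z) ∧
    c * (V.filter (· ∉ A)).card + ∑ i, E.f i (v i) ≤ C * ((V.filter (· ∈ A)).card - 1)

variable {E}

theorem Desc.eq_of_mem {a z : Site} (h : E.Desc a z) (ha : a ∈ A) : z = a := by
  cases h with
  | refl => rfl
  | step _ _ _ h => exact absurd ha h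

theorem desc_of_desc_e {x z : Site} {i : ι} (h : E.Desc (E.e i x) z) : E.Desc x z := by
  by_cases hx : x ∈ A
  · rwa [E.e_of_mem x hx] at h
  · exact .step x i z hx h

theorem Desc.exists_e [Nonempty ι] {x z : Site} (h : E.Desc x z) : ∃ i, E.Desc (E.e i x) z := by
  cases h with
  | refl _ hx =>
    inhabit ι
    refine ⟨default, ?_⟩
    rw [E.e_of_mem x hx]
    exact .refl x hx
  | step _ i _ _ h => exact ⟨i, h⟩

theorem good_singleton [Nonempty ι] {a : Site} (ha : a ∈ A) : E.Good {a} := by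
  classical
  intro v hv
  have hva : v = fun _ ↦ a := funext fun i ↦ by simpa using hv i
  subst hva
  refine ⟨{a}, .singleton a, by simp, fun z hz _ ↦ ⟨a, by simp, ?_⟩, ?_⟩
  · obtain rfl := Finset.mem_singleton.1 hz
    exact .refl z ha
  · simp [Finset.filter_singleton, ha, E.sum_eq_zero]

/-- Two good sets without common descendants joined by a step form a good set. -/
theorem Good.union {K L : Finset Site} (hK : E.Good K) (hL : E.Good L)
    (hKL : ∀ a ∈ K, ∀ b ∈ L, ∀ z, E.Desc a z → ¬ E.Desc b z) {a b : Site} (ha : a ∈ K)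
    (hb : b ∈ L) (hab : b - a ∈ B) : E.Good (K ∪ L) := by
  classical
  intro v hv
  by_cases h₁ : ∀ i, v i ∈ K
  · obtain ⟨V, hV, hvV, hd, h⟩ := hK v h₁
    refine ⟨V, hV, hvV, fun z hz hzA ↦ ?_, h⟩
    obtain ⟨k, hk, hkz⟩ := hd z hz hzA
    exact ⟨k, Finset.mem_union_left _ hk, hkz⟩
  by_cases h₂ : ∀ i, v i ∉ K
  · obtain ⟨V, hV, hvV, hd, h⟩ := hL v fun i ↦ (Finset.mem_union.1 (hv i)).resolve_left (h₂ i)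
    refine ⟨V, hV, hvV, fun z hz hzA ↦ ?_, h⟩
    obtain ⟨k, hk, hkz⟩ := hd z hz hzA
    exact ⟨k, Finset.mem_union_right _ hk, hkz⟩
  push Not at h₁ h₂
  obtain ⟨i₁, hi₁⟩ := h₁
  obtain ⟨i₂, hi₂⟩ := h₂
  obtain ⟨V, hV, hvV, hVd, hVle⟩ := hK (fun i ↦ if v i ∈ K then v i else a) fun i ↦ by
    split_ifs with h <;> assumption
  obtain ⟨W, hW, hvW, hWd, hWle⟩ := hL (fun i ↦ if v i ∈ K then b else v i) fun i ↦ by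
    split_ifs with h
    exacts [hb, (Finset.mem_union.1 (hv i)).resolve_left h]
  have haV : a ∈ V := by simpa [hi₁] using hvV i₁
  have hbW : b ∈ W := by simpa [hi₂] using hvW i₂
  refine ⟨V ∪ W, hV.union E.neg_mem hW haV hbW hab, fun i ↦ ?_, fun z hz hzA ↦ ?_, ?_⟩
  · by_cases h : v i ∈ K
    · exact Finset.mem_union_left _ (by simpa [h] using hvV i)
    · exact Finset.mem_union_right _ (by simpa [h] using hvW i)
  · rcases Finset.mem_union.1 hz with hz | hz
    · obtain ⟨k, hk, hkz⟩ := hVd z hz hzA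
      exact ⟨k, Finset.mem_union_left _ hk, hkz⟩
    · obtain ⟨k, hk, hkz⟩ := hWd z hz hzA
      exact ⟨k, Finset.mem_union_right _ hk, hkz⟩
  have hdisj : Disjoint (V.filter (· ∈ A)) (W.filter (· ∈ A)) := by
    rw [Finset.disjoint_left]
    intro z hzV hzW
    rw [Finset.mem_filter] at hzV hzW
    obtain ⟨k, hk, hkz⟩ := hVd z hzV.1 hzV.2
    obtain ⟨l, hl, hlz⟩ := hWd z hzW.1 hzW.2
    exact hKL k hk l hl z hkz hlz
  have hcardA : (((V ∪ W).filter (· ∈ A)).card : ℝ)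
      = (V.filter (· ∈ A)).card + (W.filter (· ∈ A)).card := by
    rw [Finset.filter_union, Finset.card_union_of_disjoint hdisj]
    push_cast
    rfl
  have hcard : (((V ∪ W).filter (· ∉ A)).card : ℝ)
      ≤ (V.filter (· ∉ A)).card + (W.filter (· ∉ A)).card := by
    rw [Finset.filter_union]
    exact_mod_cast Finset.card_union_le _ _
  have hspan : ∑ i, E.f i (v i) ≤ ∑ i, E.f i (if v i ∈ K then v i else a)
      + ∑ i, E.f i (if v i ∈ K then b else v i) + C := by
    have h : ∑ i, (E.f i (v i) + E.f i a) ≤ ∑ i, (E.f i (if v i ∈ K then v i else a)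
        + E.f i (if v i ∈ K then b else v i) + |E.f i (b - a)|) := by
      refine Finset.sum_le_sum fun i _ ↦ ?_
      rw [map_sub]
      split_ifs
      · linarith [neg_abs_le (E.f i b - E.f i a)]
      · linarith [abs_nonneg (E.f i b - E.f i a)]
    simp only [Finset.sum_add_distrib, E.sum_eq_zero] at h
    linarith [E.cost_le _ hab]
  rw [hcardA]
  nlinarith [mul_le_mul_of_nonneg_left hcard E.c_pos.le]

/-- Goodness passes from the explanations of a set to the set. -/
theorem Good.of_image {K : Finset Site} {t : ℕ} (hKS : ∀ x ∈ K, x ∈ S t)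
    (hK : E.Good (K.biUnion fun x ↦ Finset.univ.image fun i ↦ E.e i x)) : E.Good K := by
  classical
  intro v hv
  obtain ⟨V, hV, hvV, hVd, hVle⟩ := hK (fun i ↦ E.e i (v i)) fun i ↦
    Finset.mem_biUnion.2 ⟨v i, hv i, Finset.mem_image_of_mem _ (Finset.mem_univ i)⟩
  have hW : ∀ s : Finset ι, StepConnected B (V ∪ s.image v) := by
    intro s
    induction s using Finset.induction_on with
    | empty => simpa using hV
    | insert i s _ ih =>
      have := ih.union E.neg_mem (.singleton (v i)) (Finset.mem_union_left _ (hvV i))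
        (Finset.mem_singleton_self _) (by simpa using E.neg_mem _ (E.step_mem i (v i)))
      convert this using 1
      ext z
      simp only [Finset.mem_union, Finset.mem_image, Finset.mem_insert, Finset.mem_singleton,
        exists_eq_or_imp, eq_comm (a := z)]
      exact or_assoc.symm.trans or_right_comm
  have hmemA : ∀ i, v i ∈ A → v i ∈ V := fun i hi ↦ by simpa [E.e_of_mem _ hi] using hvV i
  have hfilter : (V ∪ Finset.univ.image v).filter (· ∈ A) = V.filter (· ∈ A) := by
    ext z
    simp only [Finset.mem_filter, Finset.mem_union, Finset.mem_image, Finset.mem_univ, true_and]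
    refine ⟨?_, fun h ↦ ⟨.inl h.1, h.2⟩⟩
    rintro ⟨h | ⟨i, rfl⟩, hz⟩
    exacts [⟨h, hz⟩, ⟨hmemA i hz, hz⟩]
  have hfilter' : ((V ∪ Finset.univ.image v).filter (· ∉ A)).card
      ≤ (V.filter (· ∉ A)).card + (Finset.univ.filter fun i ↦ v i ∉ A).card := by
    rw [Finset.filter_union, Finset.filter_image]
    exact (Finset.card_union_le _ _).trans (Nat.add_le_add_left Finset.card_image_le _)
  have hspan : ∑ i, E.f i (v i) + c * (Finset.univ.filter fun i ↦ v i ∉ A).card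
      ≤ ∑ i, E.f i (E.e i (v i)) := by
    rw [Finset.card_filter, Nat.cast_sum, Finset.mul_sum, ← Finset.sum_add_distrib]
    refine Finset.sum_le_sum fun i _ ↦ ?_
    by_cases hi : v i ∈ A
    · simp [hi, E.e_of_mem]
    · simpa [hi] using E.gain t _ (hKS _ (hv i)) hi i
  refine ⟨V ∪ Finset.univ.image v, hW _, fun i ↦ ?_, fun z hz hzA ↦ ?_, ?_⟩
  · exact Finset.mem_union_right _ (Finset.mem_image_of_mem _ (Finset.mem_univ i))
  · have hzV : z ∈ V.filter (· ∈ A) := by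
      rw [← hfilter]
      exact Finset.mem_filter.2 ⟨hz, hzA⟩
    obtain ⟨y, hy, hyz⟩ := hVd z (Finset.mem_filter.1 hzV).1 hzA
    simp only [Finset.mem_biUnion, Finset.mem_image, Finset.mem_univ, true_and] at hy
    obtain ⟨x, hx, i, rfl⟩ := hy
    exact ⟨x, hx, desc_of_desc_e hyz⟩
  · rw [hfilter]
    have : (((V ∪ Finset.univ.image v).filter (· ∉ A)).card : ℝ)
      ≤ (V.filter (· ∉ A)).card + (Finset.univ.filter fun i ↦ v i ∉ A).card :=
      mod_cast hfilter'
    nlinarith [mul_le_mul_of_nonneg_left this E.c_pos.le]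

variable (E) in
/-- `T` and `K \ T` have no common descendants. -/
def Saturated (K T : Finset Site) : Prop :=
  ∀ a ∈ T, ∀ b ∈ K \ T, ∀ z, E.Desc a z → ¬ E.Desc b z

/-- Every site of `K` lies in a linked saturated subset of `K`. -/
theorem exists_linked {K : Finset Site} {b : Site} (hb : b ∈ K) :
    ∃ T ⊆ K, b ∈ T ∧ E.Saturated K T ∧ E.Linked T := by
  classical
  obtain ⟨T, hT, hmin⟩ := (K.powerset.filter fun T ↦ b ∈ T ∧ E.Saturated K T).exists_min_image
    Finset.card ⟨K, Finset.mem_filter.2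
      ⟨Finset.mem_powerset_self K, hb, fun _ _ y hy ↦ by simp at hy⟩⟩
  simp only [Finset.mem_filter, Finset.mem_powerset] at hT hmin
  obtain ⟨hTK, hbT, hsat⟩ := hT
  refine ⟨T, hTK, hbT, hsat, fun R hRT hR hne ↦ ?_⟩
  by_contra! h
  have hlt : R.card < T.card := Finset.card_lt_card (hRT.ssubset_of_ne hne)
  have hRpos := hR.card_pos
  have hcard := Finset.card_sdiff_add_card_eq_card hRT
  by_cases hbR : b ∈ R
  · have := hmin R ⟨hRT.trans hTK, hbR, fun x hx y hy z hxz hyz ↦ ?_⟩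
    · omega
    · rw [Finset.mem_sdiff] at hy
      by_cases hyT : y ∈ T
      · exact h x hx y (Finset.mem_sdiff.2 ⟨hyT, hy.2⟩) z hxz hyz
      · exact hsat x (hRT hx) y (Finset.mem_sdiff.2 ⟨hy.1, hyT⟩) z hxz hyz
  · have := hmin (T \ R) ⟨Finset.sdiff_subset.trans hTK, Finset.mem_sdiff.2 ⟨hbT, hbR⟩,
      fun x hx y hy z hxz hyz ↦ ?_⟩
    · omega
    · rw [Finset.mem_sdiff] at hy
      by_cases hyT : y ∈ T
      · have hyR : y ∈ R := by
          by_contra hyR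
          exact hy.2 (Finset.mem_sdiff.2 ⟨hyT, hyR⟩)
        exact h y hyR x hx z hyz hxz
      · exact hsat x (Finset.mem_sdiff.1 hx).1 y (Finset.mem_sdiff.2 ⟨hy.1, hyT⟩) z hxz hyz

/-- A nonempty linked set of infected sites is good. -/
theorem Linked.good [Nonempty ι] {K : Finset Site} (hK : E.Linked K) (hne : K.Nonempty) {t : ℕ}
    (hKS : ∀ x ∈ K, x ∈ S t) : E.Good K := by
  classical
  induction t generalizing K with
  | zero =>
    rw [E.zero_eq] at hKS
    obtain ⟨a, ha⟩ := hne
    obtain rfl : {a} = K := by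
      by_contra h
      obtain ⟨x, hx, y, hy, z, hxz, hyz⟩ := hK {a} (by simpa using ha) (by simp) h
      obtain rfl := Finset.mem_singleton.1 hx
      rw [Finset.mem_sdiff, Finset.mem_singleton] at hy
      exact hy.2 ((hyz.eq_of_mem (hKS y hy.1)).symm.trans (hxz.eq_of_mem (hKS x ha)))
    exact good_singleton (hKS a (by simp))
  | succ t ih =>
    refine Good.of_image hKS ?_
    set L := K.biUnion fun x ↦ Finset.univ.image fun i ↦ E.e i x with hL
    have hmemL : ∀ x ∈ K, ∀ i, E.e i x ∈ L := fun x hx i ↦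
      Finset.mem_biUnion.2 ⟨x, hx, Finset.mem_image_of_mem _ (Finset.mem_univ i)⟩
    have hLS : ∀ y ∈ L, y ∈ S t := by
      intro y hy
      simp only [hL, Finset.mem_biUnion, Finset.mem_image, Finset.mem_univ, true_and] at hy
      obtain ⟨x, hx, i, rfl⟩ := hy
      exact E.e_mem t x (hKS x hx) i
    have hcluster : ∀ b ∈ L, ∃ T ⊆ L, b ∈ T ∧ E.Saturated L T ∧ E.Linked T ∧ E.Good T := by
      intro b hb
      obtain ⟨T, hTL, hbT, hsat, hlink⟩ := E.exists_linked hb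
      exact ⟨T, hTL, hbT, hsat, hlink, ih hlink ⟨b, hbT⟩ fun x hx ↦ hLS x (hTL hx)⟩
    obtain ⟨x₀, hx₀⟩ := hne
    obtain ⟨T₀, hT₀L, hbT₀, hsat₀, -, hgood₀⟩ := hcluster _ (hmemL x₀ hx₀ (Classical.arbitrary ι))
    obtain ⟨T, hT, hmax⟩ :=
      (L.powerset.filter fun T ↦ T.Nonempty ∧ E.Saturated L T ∧ E.Good T).exists_max_image
        Finset.card ⟨T₀, by simpa [hT₀L, hsat₀, hgood₀] using ⟨_, hbT₀⟩⟩
    simp only [Finset.mem_filter, Finset.mem_powerset] at hT hmax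
    obtain ⟨hTL, hTne, hsat, hgood⟩ := hT
    by_cases hTeq : T = L
    · rwa [← hTeq]
    exfalso
    obtain ⟨a, ha, b, hb, hab⟩ : ∃ a ∈ T, ∃ b ∈ L \ T, b - a ∈ B := by
      by_contra! h
      have hall : ∀ x ∈ K, ∀ i, E.e i x ∈ T → ∀ j, E.e j x ∈ T := by
        intro x hx i hi j
        by_contra hj
        exact h _ hi _ (Finset.mem_sdiff.2 ⟨hmemL x hx j, hj⟩) (E.fork_mem i j x)
      obtain ⟨x, hx, y, hy, z, hxz, hyz⟩ := hK (K.filter fun x ↦ ∀ i, E.e i x ∈ T)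
        (Finset.filter_subset _ _) (by
          obtain ⟨y, hy⟩ := hTne
          have hyL := hTL hy
          simp only [hL, Finset.mem_biUnion, Finset.mem_image, Finset.mem_univ, true_and] at hyL
          obtain ⟨x, hx, i, rfl⟩ := hyL
          exact ⟨x, Finset.mem_filter.2 ⟨hx, hall x hx i hy⟩⟩) (fun heq ↦ hTeq <|
          hTL.antisymm fun y hy ↦ by
            simp only [hL, Finset.mem_biUnion, Finset.mem_image, Finset.mem_univ, true_and] at hy
            obtain ⟨x, hx, i, rfl⟩ := hy
            rw [← heq] at hx
            exact (Finset.mem_filter.1 hx).2 i)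
      rw [Finset.mem_filter] at hx
      rw [Finset.mem_sdiff, Finset.mem_filter] at hy
      obtain ⟨i, hi⟩ := hxz.exists_e
      obtain ⟨j, hj⟩ := hyz.exists_e
      refine hsat _ (hx.2 i) _ (Finset.mem_sdiff.2 ⟨hmemL y hy.1 j, fun hjT ↦ ?_⟩) z hi hj
      exact hy.2 ⟨hy.1, hall y hy.1 j hjT⟩
    rw [Finset.mem_sdiff] at hb
    obtain ⟨R, hRL, hbR, hRsat, hRlink, hRgood⟩ := hcluster b hb.1
    have hRT : ∀ y ∈ R, y ∉ T := by
      by_contra! h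
      obtain ⟨y, hyR, hyT⟩ := h
      obtain ⟨x, hx, w, hw, z, hxz, hwz⟩ := hRlink (R.filter (· ∈ T)) (Finset.filter_subset _ _)
        ⟨y, Finset.mem_filter.2 ⟨hyR, hyT⟩⟩ (fun heq ↦ by
          rw [← heq] at hbR
          exact hb.2 (Finset.mem_filter.1 hbR).2)
      rw [Finset.mem_filter] at hx
      rw [Finset.mem_sdiff, Finset.mem_filter] at hw
      exact hsat x hx.2 w (Finset.mem_sdiff.2 ⟨hRL hw.1, fun h ↦ hw.2 ⟨hw.1, h⟩⟩) z hxz hwz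
    have hunion : E.Good (T ∪ R) := hgood.union hRgood
      (fun x hx y hy ↦ hsat x hx y (Finset.mem_sdiff.2 ⟨hRL hy, hRT y hy⟩)) ha hbR hab
    have hle := hmax (T ∪ R) ⟨Finset.union_subset hTL hRL, hTne.mono Finset.subset_union_left,
      fun x hx y hy z hxz hyz ↦ ?_, hunion⟩
    · exact hb.2 <| (Finset.eq_of_subset_of_card_le Finset.subset_union_left hle).symm ▸
        Finset.mem_union_right T hbR
    · rw [Finset.mem_sdiff, Finset.mem_union] at hy
      push Not at hy
      rcases Finset.mem_union.1 hx with hx | hx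
      · exact hsat x hx y (Finset.mem_sdiff.2 ⟨hy.1, hy.2.1⟩) z hxz hyz
      · exact hRsat x hx y (Finset.mem_sdiff.2 ⟨hy.1, hy.2.2⟩) z hxz hyz

end Explanation

/-- The sets of `N` sites that are visited by a walk of `L * N` steps in `B` started at `x`. -/
def witnesses (B : Finset Site) (L N : ℕ) (x : Site) : Finset (Finset Site) :=
  (walkRanges B (L * N) x).biUnion (Finset.powersetCard N)

theorem card_witnesses_le (B : Finset Site) {L N : ℕ} (hL : 1 ≤ L) (hN : 1 ≤ N) (x : Site) :
    (witnesses B L N x).card ≤ (B.card ^ L * 2 ^ (2 * L)) ^ N := by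
  have h : (witnesses B L N x).card ≤ (walkRanges B (L * N) x).card * 2 ^ (L * N + 1) :=
    Finset.card_biUnion_le_card_mul _ _ _ fun R hR ↦ by
      rw [Finset.card_powersetCard]
      exact (Nat.choose_le_two_pow _ _).trans
        (Nat.pow_le_pow_right two_pos (walkRanges.card_range_le hR))
  calc
    _ ≤ (walkRanges B (L * N) x).card * 2 ^ (L * N + 1) := h
    _ ≤ B.card ^ (L * N) * 2 ^ (2 * L * N) := by
      refine Nat.mul_le_mul (walkRanges.card_le _ _) (Nat.pow_le_pow_right two_pos ?_)
      nlinarith [Nat.mul_le_mul hL hN]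
    _ = _ := by rw [mul_pow, ← pow_mul, ← pow_mul]

namespace Explanation

variable {ι : Type} [Fintype ι] [Nonempty ι] {A : Set Site} {S : ℕ → Set Site} {B : Finset Site}
  {c C : ℝ}

theorem exists_witness (E : Explanation ι B c C A S) {t : ℕ} {x : Site} (hx : x ∈ S t) {L : ℕ}
    (hL : 2 * (C / c + 1) ≤ L) : ∃ N, ∃ F ∈ witnesses B L (N + 1) x, ∀ z ∈ F, z ∈ A := by
  classical
  have hlinked : E.Linked {x} := fun T hT hTne hTx ↦
    absurd ((Finset.subset_singleton_iff.1 hT).resolve_left hTne.ne_empty) hTx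
  obtain ⟨V, hV, hxV, -, hVle⟩ := hlinked.good (Finset.singleton_nonempty x)
    (fun y hy ↦ by rwa [Finset.mem_singleton.1 hy]) (fun _ ↦ x) (by simp)
  replace hxV := hxV (Classical.arbitrary ι)
  have hB : (0 : Site) ∈ B := by
    simpa using E.fork_mem (Classical.arbitrary ι) (Classical.arbitrary ι) x
  have hC : 0 ≤ C := (Finset.sum_nonneg fun i _ ↦ abs_nonneg _).trans (E.cost_le 0 hB)
  have hc := E.c_pos
  have hsplit := Finset.card_filter_add_card_filter_not (s := V) (· ∈ A)
  rw [E.sum_eq_zero, add_zero] at hVle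
  set a := (V.filter (· ∈ A)).card with ha
  set b := (V.filter (· ∉ A)).card
  have hVpos : 0 < V.card := Finset.card_pos.2 ⟨x, hxV⟩
  have hb : (b : ℝ) ≤ C / c * (a - 1) := by
    rw [div_mul_eq_mul_div, le_div_iff₀ hc]
    linarith
  have hCc : 0 ≤ C / c := by positivity
  have hapos : a ≠ 0 := by
    intro h
    rw [h] at hb
    have : (0 : ℝ) < b := by
      rw [h, zero_add] at hsplit
      rw [hsplit]
      exact_mod_cast hVpos
    push_cast at hb
    linarith
  obtain ⟨N, hN⟩ := Nat.exists_eq_succ_of_ne_zero hapos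
  have hlen : 2 * (V.card - 1) ≤ L * (N + 1) := by
    have h : (2 * V.card : ℝ) ≤ L * (N + 1) := by
      rw [hN] at hsplit hb
      rw [← hsplit]
      push_cast at hb ⊢
      nlinarith [mul_le_mul_of_nonneg_right hL (show (0 : ℝ) ≤ N + 1 by positivity)]
    have h' : 2 * V.card ≤ L * (N + 1) := by exact_mod_cast h
    omega
  exact ⟨N, V.filter (· ∈ A), Finset.mem_biUnion.2
    ⟨V, walkRanges.mono hB x hlen (hV.mem_walkRanges E.neg_mem hxV),
      Finset.mem_powersetCard.2 ⟨Finset.filter_subset _ _, hN⟩⟩,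
    fun z hz ↦ (Finset.mem_filter.1 hz).2⟩

end Explanation

open scoped ENNReal

/-- For every `p ∈ [0, 1]` there is a Bernoulli measure of density `p`. -/
theorem exists_isBernoulli {p : ℝ} (hp : p ∈ Set.Icc (0 : ℝ) 1) :
    ∃ μ : Measure (Site → Bool), IsBernoulli p μ := by
  set ν : Measure Bool :=
    ENNReal.ofReal p • Measure.dirac true + ENNReal.ofReal (1 - p) • Measure.dirac false with hν
  have : IsProbabilityMeasure ν := ⟨by
    simp [hν, ← ENNReal.ofReal_add hp.1 (sub_nonneg.2 hp.2)]⟩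
  refine ⟨Measure.infinitePi fun _ ↦ ν, fun s f ↦ ?_⟩
  have hset : {ω : Site → Bool | ∀ x ∈ s, ω x = f x} = Set.pi s fun x ↦ {f x} := by
    ext ω
    simp
  rw [hset, Measure.infinitePi_pi _ fun _ _ ↦ measurableSet_singleton _]
  refine Finset.prod_congr rfl fun x _ ↦ ?_
  cases f x <;> simp [hν]

theorem IsBernoulli.measure_forall_true {p : ℝ} {μ : Measure (Site → Bool)}
    (hμ : IsBernoulli p μ) (F : Finset Site) :
    μ {ω | ∀ x ∈ F, ω x = true} = ENNReal.ofReal p ^ F.card := by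
  simpa using hμ F fun _ ↦ true

/-- At density one, every site is infected from the start. -/
theorem IsBernoulli.percolates_one (U : Finset (Finset Site)) {μ : Measure (Site → Bool)}
    (hμ : IsBernoulli 1 μ) : μ {ω | Percolates U (siteSet ω)} = 1 := by
  have : IsProbabilityMeasure μ := ⟨by simpa using hμ ∅ fun _ ↦ true⟩
  have hae : ∀ᵐ ω ∂μ, ∀ x : Site, ω x = true := by
    rw [ae_all_iff]
    intro x
    rw [ae_iff]
    simpa using hμ {x} fun _ ↦ false
  have hperc : ∀ᵐ ω ∂μ, Percolates U (siteSet ω) := hae.mono fun ω hω ↦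
    Set.eq_univ_of_forall fun x ↦ Set.mem_iUnion.2 ⟨0, hω x⟩
  exact (measure_congr (Filter.eventuallyEq_univ.2 hperc)).trans measure_univ

/-- The union bound over witnesses. -/
theorem IsBernoulli.measure_witness_lt_one {B : Finset Site} {L : ℕ} (hL : 1 ≤ L) (x : Site)
    {p : ℝ} (hp : 4 * (B.card ^ L * 2 ^ (2 * L) : ℕ) * p ≤ 1) {μ : Measure (Site → Bool)}
    (hμ : IsBernoulli p μ) :
    μ {ω | ∃ N, ∃ F ∈ witnesses B L (N + 1) x, ∀ z ∈ F, z ∈ siteSet ω} < 1 := by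
  set M := B.card ^ L * 2 ^ (2 * L)
  have hMp : (M : ℝ≥0∞) * ENNReal.ofReal p ≤ 4⁻¹ := by
    rw [← ENNReal.ofReal_natCast, ← ENNReal.ofReal_mul (by positivity)]
    refine (ENNReal.ofReal_le_ofReal (show (M : ℝ) * p ≤ 4⁻¹ by linarith)).trans_eq ?_
    rw [ENNReal.ofReal_inv_of_pos (by norm_num)]
    norm_num
  have hset : {ω : Site → Bool | ∃ N, ∃ F ∈ witnesses B L (N + 1) x, ∀ z ∈ F, z ∈ siteSet ω}
      = ⋃ N, ⋃ F ∈ witnesses B L (N + 1) x, {ω | ∀ z ∈ F, ω z = true} := by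
    ext ω
    simp [siteSet]
  calc
    _ ≤ ∑' N, ∑ F ∈ witnesses B L (N + 1) x, μ {ω | ∀ z ∈ F, ω z = true} := by
      rw [hset]
      exact (measure_iUnion_le _).trans
        (ENNReal.tsum_le_tsum fun N ↦ measure_biUnion_finset_le _ _)
    _ ≤ ∑' N : ℕ, (4⁻¹ : ℝ≥0∞) ^ (N + 1) := by
      refine ENNReal.tsum_le_tsum fun N ↦ ?_
      have hcard : ∀ F ∈ witnesses B L (N + 1) x, F.card = N + 1 := by
        intro F hF
        obtain ⟨R, -, hR⟩ := Finset.mem_biUnion.1 hF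
        exact (Finset.mem_powersetCard.1 hR).2
      calc
        _ = ∑ F ∈ witnesses B L (N + 1) x, ENNReal.ofReal p ^ (N + 1) :=
          Finset.sum_congr rfl fun F hF ↦ by rw [hμ.measure_forall_true, hcard F hF]
        _ = (witnesses B L (N + 1) x).card * ENNReal.ofReal p ^ (N + 1) := by simp
        _ ≤ ((M ^ (N + 1) : ℕ) : ℝ≥0∞) * ENNReal.ofReal p ^ (N + 1) := by
          gcongr
          exact card_witnesses_le B hL (by omega) x
        _ = (M * ENNReal.ofReal p) ^ (N + 1) := by push_cast; rw [mul_pow]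
        _ ≤ _ := by gcongr
    _ < 1 := by
      have h4 : (4⁻¹ : ℝ≥0∞) = ENNReal.ofReal 4⁻¹ := by
        rw [ENNReal.ofReal_inv_of_pos (by norm_num)]
        norm_num
      rw [ENNReal.tsum_geometric_add_one, h4, ← ENNReal.ofReal_one,
        ← ENNReal.ofReal_sub _ (by norm_num), ← ENNReal.ofReal_inv_of_pos (by norm_num),
        ← ENNReal.ofReal_mul (by norm_num), ENNReal.ofReal_lt_ofReal_iff (by norm_num)]
      norm_num

/-- The linear functional on the lattice given by the inner product with `u`. -/
noncomputable def latticeFunctional (u : ℝ × ℝ) : Site →+ ℝ where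
  toFun x := x.1 * u.1 + x.2 * u.2
  map_zero' := by simp
  map_add' x y := by
    simp only [Prod.fst_add, Prod.snd_add]
    push_cast
    ring

theorem latticeFunctional_apply (u : ℝ × ℝ) (x : Site) :
    latticeFunctional u x = x.1 * u.1 + x.2 * u.2 := rfl

/-- The vectors `u` such that every update rule has a site with positive inner product with `u`. -/
def blockingDirs (U : Finset (Finset Site)) : Set (ℝ × ℝ) :=
  {u | ∀ X ∈ U, ∃ y ∈ X, 0 < latticeFunctional u y}

theorem isOpen_blockingDirs (U : Finset (Finset Site)) : IsOpen (blockingDirs U) := by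
  have : blockingDirs U = ⋂ X ∈ U, ⋃ y ∈ X, {u | 0 < latticeFunctional u y} := by
    ext u
    simp [blockingDirs]
  rw [this]
  refine isOpen_biInter_finset fun X _ ↦ isOpen_biUnion fun y _ ↦ ?_
  simp only [latticeFunctional_apply]
  exact isOpen_lt continuous_const (by fun_prop)

theorem smul_mem_blockingDirs {U : Finset (Finset Site)} {u : ℝ × ℝ} (hu : u ∈ blockingDirs U)
    {w : ℝ} (hw : 0 < w) : w • u ∈ blockingDirs U := by
  intro X hX
  obtain ⟨y, hy, h⟩ := hu X hX
  refine ⟨y, hy, ?_⟩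
  rw [latticeFunctional_apply] at h ⊢
  simp only [Prod.smul_fst, Prod.smul_snd, smul_eq_mul]
  nlinarith [mul_pos hw h]

/-- For a stable direction, no update rule is contained in the half-plane. -/
theorem IsStableDir.exists_nonneg {U : Finset (Finset Site)} {u : ℝ × ℝ} (hu : IsStableDir U u)
    {X : Finset Site} (hX : X ∈ U) : ∃ y ∈ X, 0 ≤ latticeFunctional u y := by
  by_contra! h
  have h0 : (0 : Site) ∈ bsClosure U (halfPlane u) :=
    Set.mem_iUnion.2 ⟨1, .inr ⟨X, hX, fun y hy ↦ by
      rw [add_zero]; exact h y hy⟩⟩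
  rw [hu] at h0
  simp [halfPlane] at h0

/-- Two angles at distance less than `π` cannot both be perpendicular to a nonzero site. -/
theorem eq_zero_of_latticeFunctional_dir {y : Site} {φ ψ : ℝ} (hφψ : φ ≠ ψ)
    (hlt : |φ - ψ| < Real.pi) (hφ : latticeFunctional (dir φ) y = 0)
    (hψ : latticeFunctional (dir ψ) y = 0) : y = 0 := by
  simp only [latticeFunctional_apply, dir] at hφ hψ
  have hsin : Real.sin (φ - ψ) ≠ 0 := fun h ↦ sub_ne_zero.2 hφψ <|
    (Real.sin_eq_zero_iff_of_lt_of_lt (abs_lt.1 hlt).1 (abs_lt.1 hlt).2).1 h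
  rw [Real.sin_sub] at hsin
  have h1 : (y.1 : ℝ) * (Real.sin φ * Real.cos ψ - Real.cos φ * Real.sin ψ) = 0 := by
    linear_combination Real.sin φ * hψ - Real.sin ψ * hφ
  have h2 : (y.2 : ℝ) * (Real.sin φ * Real.cos ψ - Real.cos φ * Real.sin ψ) = 0 := by
    linear_combination Real.cos ψ * hφ - Real.cos φ * hψ
  ext
  · simpa [hsin] using h1
  · simpa [hsin] using h2

/-- Arbitrarily close to a strongly stable angle there are blocking directions. -/
theorem IsStronglyStableAngle.exists_blockingDirs {U : Finset (Finset Site)}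
    (hU : IsUpdateFamily U) {φ : ℝ} (hφ : IsStronglyStableAngle U φ) {δ : ℝ} (hδ : 0 < δ) :
    ∃ ψ, φ < ψ ∧ ψ < φ + δ ∧ dir ψ ∈ blockingDirs U := by
  obtain ⟨ε, hε, hst⟩ := hφ
  set η := min (min ε δ) 1 with hη
  have hηpos : 0 < η := by positivity
  have hηle : η ≤ ε ∧ η ≤ δ ∧ η ≤ 1 := by simp [hη]
  set bad : Set ℝ := ⋃ X ∈ U, ⋃ y ∈ X,
    {ψ | ψ ∈ Set.Ioo φ (φ + η) ∧ latticeFunctional (dir ψ) y = 0} with hbad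
  have hfin : bad.Finite := by
    refine U.finite_toSet.biUnion fun X hX ↦ X.finite_toSet.biUnion fun y hy ↦
      Set.Subsingleton.finite fun ψ hψ χ hχ ↦ ?_
    by_contra hne
    refine (hU.2 X hX).2 (eq_zero_of_latticeFunctional_dir hne ?_ hψ.2 hχ.2 ▸ hy)
    have := Real.pi_gt_three
    rw [abs_lt]
    constructor <;> linarith [hψ.1.1, hψ.1.2, hχ.1.1, hχ.1.2]
  obtain ⟨ψ, hψ, hψbad⟩ := ((Set.Ioo_infinite (lt_add_of_pos_right φ hηpos)).sdiff hfin).nonempty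
  refine ⟨ψ, hψ.1, by linarith [hψ.2], fun X hX ↦ ?_⟩
  obtain ⟨y, hy, hy0⟩ := (hst ψ (by
    rw [abs_lt]
    constructor <;> linarith [hψ.1, hψ.2])).exists_nonneg hX
  refine ⟨y, hy, hy0.lt_of_ne' fun h ↦ hψbad ?_⟩
  simp only [hbad, Set.mem_iUnion]
  exact ⟨X, hX, y, hy, hψ, h⟩

/-- For a subcritical family, every nontrivial open half-plane contains a blocking direction. -/
theorem Subcritical.exists_blockingDirs {U : Finset (Finset Site)} (hU : IsUpdateFamily U)
    (hsub : Subcritical U) (r α : ℝ) (hr : 0 < r) :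
    ∃ u ∈ blockingDirs U, 0 < u.1 * (r * Real.cos α) + u.2 * (r * Real.sin α) := by
  obtain ⟨φ, h1, h2, hφ⟩ := hsub (α - Real.pi / 2)
  obtain ⟨ψ, h3, h4, hψ⟩ := hφ.exists_blockingDirs hU
    (δ := α + Real.pi / 2 - φ) (by linarith)
  refine ⟨dir ψ, hψ, ?_⟩
  have hcos : 0 < Real.cos (ψ - α) := Real.cos_pos_of_mem_Ioo ⟨by linarith, by linarith⟩
  rw [Real.cos_sub] at hcos
  simp only [dir]
  nlinarith [mul_pos hr hcos]

theorem Subcritical.zero_mem_convexHull {U : Finset (Finset Site)} (hU : IsUpdateFamily U)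
    (hsub : Subcritical U) : (0 : ℝ × ℝ) ∈ convexHull ℝ (blockingDirs U) := by
  by_contra h0
  obtain ⟨g, hg⟩ := geometric_hahn_banach_open_point (convex_convexHull ℝ (blockingDirs U))
    (isOpen_blockingDirs U).convexHull h0
  replace hg : ∀ u ∈ blockingDirs U, g u < 0 := fun u hu ↦ by
    simpa using hg u (subset_convexHull ℝ _ hu)
  have hgu : ∀ u : ℝ × ℝ, g u = u.1 * g (1, 0) + u.2 * g (0, 1) := fun u ↦ by
    rw [← smul_eq_mul, ← smul_eq_mul, ← map_smul, ← map_smul, ← map_add]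
    simp
  set z : ℂ := ⟨g (1, 0), g (0, 1)⟩ with hz
  have hzero : z ≠ 0 := by
    intro h
    obtain ⟨u, hu, -⟩ := hsub.exists_blockingDirs hU 1 0 one_pos
    have h1 : g (1, 0) = 0 := congrArg Complex.re h
    have h2 : g (0, 1) = 0 := congrArg Complex.im h
    have := hg u hu
    rw [hgu, h1, h2] at this
    simp at this
  obtain ⟨u, hu, hpos⟩ := hsub.exists_blockingDirs hU ‖z‖ z.arg (norm_pos_iff.2 hzero)
  rw [Complex.norm_mul_cos_arg, Complex.norm_mul_sin_arg] at hpos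
  have := hg u hu
  rw [hgu] at this
  exact lt_asymm hpos this

/-- A subcritical family has finitely many blocking directions with sum zero. -/
theorem Subcritical.exists_sum_eq_zero {U : Finset (Finset Site)} (hU : IsUpdateFamily U)
    (hsub : Subcritical U) : ∃ (ι : Type) (_ : Fintype ι) (_ : Nonempty ι) (u : ι → ℝ × ℝ),
      (∀ i, u i ∈ blockingDirs U) ∧ ∑ i, u i = 0 := by
  classical
  obtain ⟨ι, _, w, z, hw, hw1, hz, hsum⟩ :=
    mem_convexHull_iff_exists_fintype.1 (hsub.zero_mem_convexHull hU)
  refine ⟨{i // 0 < w i}, inferInstance, ?_, fun i ↦ w i • z i,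
    fun i ↦ smul_mem_blockingDirs (hz i) i.2, ?_⟩
  · by_contra h
    simp only [nonempty_subtype, not_exists, not_lt] at h
    have := Finset.sum_nonpos fun i (_ : i ∈ Finset.univ) ↦ h i
    linarith
  · rw [← hsum, ← Finset.sum_filter_of_ne (p := fun i ↦ 0 < w i)]
    · exact (Finset.sum_subtype _ (by simp) fun i ↦ w i • z i).symm
    · exact fun i _ hi ↦ (hw i).lt_of_ne' fun h ↦ hi (by rw [h, zero_smul])

theorem bsIter_mono (U : Finset (Finset Site)) (A : Set Site) : Monotone fun t ↦ bsIter U t A :=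
  monotone_nat_of_le_succ fun _ _ hx ↦ .inl hx

/-- A site outside `A` that becomes infected is infected by the sites of some update rule, all of
which are infected before it. -/
theorem exists_rule {U : Finset (Finset Site)} (hU : U.Nonempty) {A : Set Site} {x : Site}
    (hxA : x ∉ A) : ∃ X ∈ U, ∀ t, x ∈ bsIter U t A → ∃ s < t, ∀ y ∈ X, y + x ∈ bsIter U s A := by
  classical
  by_cases hex : ∃ t, x ∈ bsIter U t A
  swap
  · obtain ⟨X, hX⟩ := hU
    exact ⟨X, hX, fun t ht ↦ absurd ⟨t, ht⟩ hex⟩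
  obtain ⟨s, hs⟩ := Nat.exists_eq_succ_of_ne_zero (n := Nat.find hex) fun h ↦ by
    have := Nat.find_spec hex
    rw [h] at this
    exact hxA this
  have hmem := Nat.find_spec hex
  rw [hs] at hmem
  obtain ⟨X, hX, h⟩ := hmem.resolve_left (Nat.find_min hex (by omega))
  refine ⟨X, hX, fun t ht ↦ ⟨s, ?_, h⟩⟩
  have := Nat.find_min' hex ht
  omega

/-- The gains along finitely many blocking directions are bounded below. -/
theorem exists_gain {ι : Type} [Fintype ι] {U : Finset (Finset Site)} {u : ι → ℝ × ℝ}
    (hu : ∀ i, u i ∈ blockingDirs U) :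
    ∃ c > 0, ∀ i, ∀ X ∈ U, ∃ y ∈ X, c ≤ latticeFunctional (u i) y := by
  choose! y hy hpos using hu
  have hev : ∀ᶠ c in nhdsWithin (0 : ℝ) (Set.Ioi 0),
      ∀ i, ∀ X ∈ U, c ≤ latticeFunctional (u i) (y i X) :=
    Filter.eventually_all.2 fun i ↦ (Filter.eventually_all_finset U).2 fun X hX ↦
      (eventually_le_nhds (hpos i X hX)).filter_mono nhdsWithin_le_nhds
  obtain ⟨c, hc, hc0⟩ := (hev.and self_mem_nhdsWithin).exists
  exact ⟨c, hc0, fun i X hX ↦ ⟨y i X, hy i X hX, hc i X hX⟩⟩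

/-- In a subcritical process infections admit explanations with uniform parameters. -/
theorem Subcritical.exists_explanation {U : Finset (Finset Site)} (hU : IsUpdateFamily U)
    (hsub : Subcritical U) : ∃ (ι : Type) (_ : Fintype ι) (_ : Nonempty ι) (B : Finset Site)
      (c C : ℝ), ∀ A : Set Site, Nonempty (Explanation ι B c C A fun t ↦ bsIter U t A) := by
  classical
  obtain ⟨ι, _, hι, u, hu, hsum⟩ := hsub.exists_sum_eq_zero hU
  obtain ⟨c, hc, hgain⟩ := exists_gain hu
  choose! y hy hyc using hgain
  set Y : Finset Site := insert 0 (U.biUnion id)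
  set B : Finset Site := (Y ×ˢ Y).image fun q ↦ q.1 - q.2
  have hB : ∀ a ∈ Y, ∀ b ∈ Y, a - b ∈ B := fun a ha b hb ↦
    Finset.mem_image.2 ⟨(a, b), Finset.mem_product.2 ⟨ha, hb⟩, rfl⟩
  have h0 : (0 : Site) ∈ Y := Finset.mem_insert_self _ _
  have hyY : ∀ i, ∀ X ∈ U, y i X ∈ Y := fun i X hX ↦
    Finset.mem_insert_of_mem (Finset.mem_biUnion.2 ⟨X, hX, hy i X hX⟩)
  refine ⟨ι, inferInstance, hι, B, c, ∑ b ∈ B, ∑ i, |latticeFunctional (u i) b|, fun A ↦ ?_⟩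
  have hrule : ∀ x, ∃ X ∈ U, x ∉ A →
      ∀ t, x ∈ bsIter U t A → ∃ s < t, ∀ y ∈ X, y + x ∈ bsIter U s A := fun x ↦ by
    by_cases hx : x ∈ A
    · obtain ⟨X, hX⟩ := hU.1
      exact ⟨X, hX, fun h ↦ absurd hx h⟩
    · obtain ⟨X, hX, h⟩ := exists_rule hU.1 hx
      exact ⟨X, hX, fun _ ↦ h⟩
  choose X hXU hX using hrule
  exact ⟨{
    e := fun i x ↦ if x ∈ A then x else y i (X x) + x
    f := fun i ↦ latticeFunctional (u i)
    zero_eq := rfl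
    e_of_mem := fun x hx i ↦ if_pos hx
    e_mem := fun t x hx i ↦ by
      split_ifs with hxA
      · exact bsIter_mono U A t.zero_le hxA
      · obtain ⟨s, hs, h⟩ := hX x hxA _ hx
        exact bsIter_mono U A (Nat.lt_succ_iff.1 hs) (h _ (hy i _ (hXU x)))
    gain := fun t x _ hxA i ↦ by
      rw [if_neg hxA, map_add, add_comm]
      linarith [hyc i _ (hXU x)]
    sum_eq_zero := fun x ↦ by
      have h1 := congrArg Prod.fst hsum
      have h2 := congrArg Prod.snd hsum
      rw [Prod.fst_sum] at h1
      rw [Prod.snd_sum] at h2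
      simp only [latticeFunctional_apply, Finset.sum_add_distrib, ← Finset.mul_sum, h1, h2]
      simp
    neg_mem := fun b hb ↦ by
      obtain ⟨q, hq, rfl⟩ := Finset.mem_image.1 hb
      rw [Finset.mem_product] at hq
      rw [neg_sub]
      exact hB _ hq.2 _ hq.1
    step_mem := fun i x ↦ by
      split_ifs
      · simpa using hB 0 h0 0 h0
      · simpa using hB _ (hyY i _ (hXU x)) 0 h0
    fork_mem := fun i j x ↦ by
      split_ifs
      · simpa using hB 0 h0 0 h0
      · simpa using hB _ (hyY j _ (hXU x)) _ (hyY i _ (hXU x))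
    cost_le := fun b hb ↦ Finset.single_le_sum (f := fun b ↦ ∑ i, |latticeFunctional (u i) b|)
      (fun _ _ ↦ Finset.sum_nonneg fun _ _ ↦ abs_nonneg _) hb
    c_pos := hc }⟩

/-- Let `U` be a subcritical update family in two dimensions.
Then `p_c(ℤ², U) > 0`. -/
theorem subcritical_critProb_pos
    (U : Finset (Finset Site)) (hU : IsUpdateFamily U) (hsub : Subcritical U) :
    0 < critProb U := by
  obtain ⟨ι, _, _, B, c, C, hE⟩ := hsub.exists_explanation hU
  set L := ⌈2 * (C / c + 1)⌉₊ + 1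
  set M := B.card ^ L * 2 ^ (2 * L)
  have hL : 2 * (C / c + 1) ≤ L := by
    push_cast [L]
    linarith [Nat.le_ceil (2 * (C / c + 1))]
  have hM : (0 : ℝ) < 4 * M + 1 := by positivity
  refine (inv_pos.2 hM).trans_le (le_csInf ⟨1, ⟨zero_le_one, le_rfl⟩, fun μ hμ ↦
    hμ.percolates_one U⟩ ?_)
  rintro p ⟨hp, hperc⟩
  by_contra! hlt
  obtain ⟨μ, hμ⟩ := exists_isBernoulli hp
  have hpM : (4 * M + 1) * p < 1 := by
    rwa [← lt_inv_mul_iff₀ hM, mul_one]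
  have hwit := hμ.measure_witness_lt_one (B := B) (L := L) (by omega) 0 (by
    linarith [hp.1] : 4 * (M : ℝ) * p ≤ 1)
  refine (measure_mono fun ω (hω : Percolates U (siteSet ω)) ↦ ?_).trans_lt hwit |>.ne (hperc μ hμ)
  obtain ⟨E⟩ := hE (siteSet ω)
  obtain ⟨t, ht⟩ := Set.mem_iUnion.1 (hω.symm ▸ Set.mem_univ (0 : Site) :
    (0 : Site) ∈ bsClosure U (siteSet ω))
  exact E.exists_witness ht hL
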